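/- Let Q be the quiver whose vertices are the objects of Ω_n^epi and whose arrows are the degree-1 morphisms. The canonical functor from the path category of Q to Ω_n^epi induces an isomorphism of categories from the quotient of the path category by the congruence generated by the relations v_1 ∘ w_1 = v_2 ∘ w_2 — one relation for each degree-2 morphism of Ω_n^epi, with its two factorizations into degree-1 morphisms — onto Ω_n^epi. In other words, Ω_n^epi is generated by its degree-1 morphisms subject only to these quadratic relations. -/

import Mathlib

open CategoryTheory

/-- An object of the category `Ω_n^epi` of pruned `n`-level trees: a sequence of
monotone surjections `T_0 → T_1 → ⋯ → T_n` between the finite ordered sets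
`T_i = Fin (t i)`, with `T_n` (and all higher levels) a one-point set. -/
structure PTree (n : ℕ) where
  t : ℕ → ℕ
  map : ∀ i : ℕ, Fin (t i) → Fin (t (i+1))
  mono : ∀ i, Monotone (map i)
  surjmap : ∀ i, Function.Surjective (map i)
  top : ∀ i, n ≤ i → t i = 1

/-- A morphism of pruned trees: a family of surjections commuting with the
structure maps, order-preserving on every fiber of the structure maps. -/
structure PTreeHom {n : ℕ} (τ σ : PTree n) where
  app : ∀ i, Fin (τ.t i) → Fin (σ.t i)
  surj : ∀ i, Function.Surjective (app i)
  comm : ∀ i x, app (i+1) (τ.map i x) = σ.map i (app i x)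
  fiberMono : ∀ i x y, τ.map i x = τ.map i y → x ≤ y → app i x ≤ app i y

theorem PTreeHom.ext' {n : ℕ} {τ σ : PTree n} {f g : PTreeHom τ σ}
    (h : f.app = g.app) : f = g := by
  cases f; cases g; cases h; rfl

instance (n : ℕ) : Category (PTree n) where
  Hom := PTreeHom
  id τ := ⟨fun _ => _root_.id, fun _ => Function.surjective_id, fun _ _ => rfl,
    fun _ _ _ _ h => h⟩
  comp f g :=
    ⟨fun i => g.app i ∘ f.app i,
     fun i => (g.surj i).comp (f.surj i),
     fun i x => by simp only [Function.comp_apply, f.comm, g.comm],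
     fun i x y hxy hle =>
       g.fiberMono i _ _ (by rw [← f.comm, ← f.comm, hxy]) (f.fiberMono i x y hxy hle)⟩
  id_comp _ := PTreeHom.ext' rfl
  comp_id _ := PTreeHom.ext' rfl
  assoc _ _ _ := PTreeHom.ext' rfl

/-- The degree of a pruned tree: the number of vertices of levels `0,…,n-1`. -/
def PTree.deg {n : ℕ} (τ : PTree n) : ℕ := ∑ i ∈ Finset.range n, τ.t i

/-- The degree of a morphism `u : τ ⟶ σ`: `deg τ - deg σ`. -/
def homDeg {n : ℕ} {τ σ : PTree n} (_ : τ ⟶ σ) : ℤ :=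
  (τ.deg : ℤ) - (σ.deg : ℤ)

/-- A morphism (with possibly different source and target) is an identity. -/
def IsIdentityHom {n : ℕ} {τ σ : PTree n} (u : τ ⟶ σ) : Prop :=
  ∃ h : τ = σ, u = eqToHom h

/-- The vertices of the quiver of degree-1 morphisms: the objects of
`Ω_n^epi`. -/
structure TreeVert (n : ℕ) where
  tree : PTree n

/-- The quiver whose arrows are the degree-1 morphisms of `Ω_n^epi`. -/
instance (n : ℕ) : Quiver (TreeVert n) where
  Hom a b := {u : a.tree ⟶ b.tree // homDeg u = 1}

/-- Identification of the objects of the path category with the vertices. -/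
def toV {n : ℕ} (a : Paths (TreeVert n)) : TreeVert n := a

/-- The canonical functor from the path category of the quiver of degree-1
morphisms to `Ω_n^epi`. -/
def pathsLift (n : ℕ) : CategoryTheory.Paths (TreeVert n) ⥤ PTree n :=
  Paths.lift { obj := fun a => a.tree, map := fun u => u.val }

/-- The relations: two (2-step) paths are related whenever they are the two
factorizations into degree-1 morphisms of one and the same (degree-2)
morphism of `Ω_n^epi`. -/
def relR (n : ℕ) : HomRel (CategoryTheory.Paths (TreeVert n)) :=
  fun a b p q =>
    ∃ (θ₁ θ₂ : TreeVert n)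
      (w₁ : toV a ⟶ θ₁) (v₁ : θ₁ ⟶ toV b)
      (w₂ : toV a ⟶ θ₂) (v₂ : θ₂ ⟶ toV b),
      p = (Paths.of (V := TreeVert n)).map w₁ ≫
            (Paths.of (V := TreeVert n)).map v₁ ∧
      q = (Paths.of (V := TreeVert n)).map w₂ ≫
            (Paths.of (V := TreeVert n)).map v₂ ∧
      w₁.val ≫ v₁.val = w₂.val ≫ v₂.val

namespace PTree

variable {n : ℕ} {a b c : PTree n}

/-- The component of a morphism of pruned trees at level `k`. -/
def lev (w : a ⟶ b) (k : ℕ) : Fin (a.t k) → Fin (b.t k) := PTreeHom.app w k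

theorem lev_surjective (w : a ⟶ b) (k : ℕ) : Function.Surjective (lev w k) :=
  PTreeHom.surj w k

theorem lev_map (w : a ⟶ b) (k : ℕ) (z : Fin (a.t k)) :
    lev w (k + 1) (a.map k z) = b.map k (lev w k z) :=
  PTreeHom.comm w k z

theorem lev_mono (w : a ⟶ b) {k : ℕ} {z z' : Fin (a.t k)} (h : a.map k z = a.map k z')
    (hz : z ≤ z') : lev w k z ≤ lev w k z' :=
  PTreeHom.fiberMono w k z z' h hz

theorem lev_comp (w : a ⟶ b) (v : b ⟶ c) (k : ℕ) (z : Fin (a.t k)) :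
    lev (w ≫ v) k z = lev v k (lev w k z) := rfl

theorem hom_ext {w w' : a ⟶ b} (h : ∀ k z, lev w k z = lev w' k z) : w = w' :=
  PTreeHom.ext' (funext fun k => funext fun z => h k z)

theorem eq_of_le (a : PTree n) {k : ℕ} (hk : n ≤ k) (z z' : Fin (a.t k)) : z = z' := by
  have := a.top k hk
  apply Fin.ext
  omega

theorem t_le (w : a ⟶ b) (k : ℕ) : b.t k ≤ a.t k := by
  simpa using Fintype.card_le_of_surjective _ (lev_surjective w k)

theorem deg_le (w : a ⟶ b) : b.deg ≤ a.deg := Finset.sum_le_sum fun k _ => t_le w k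

theorem t_lt (w : a ⟶ b) {k : ℕ} {z z' : Fin (a.t k)} (hne : z ≠ z')
    (h : lev w k z = lev w k z') : b.t k < a.t k := by
  refine lt_of_le_of_ne (t_le w k) fun he => hne ?_
  have := (Fintype.bijective_iff_surjective_and_card (lev w k)).2
    ⟨lev_surjective w k, by simp [he]⟩
  exact this.1 h

theorem deg_lt (w : a ⟶ b) {k : ℕ} {z z' : Fin (a.t k)} (hne : z ≠ z')
    (h : lev w k z = lev w k z') : b.deg < a.deg := by
  refine Finset.sum_lt_sum (fun k _ => t_le w k) ⟨k, ?_, t_lt w hne h⟩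
  by_contra hk
  exact hne (a.eq_of_le (by simpa using hk) z z')

theorem deg_le_add_card (w : a ⟶ b) (B : Finset (ℕ × ℕ))
    (hB : ∀ k (z z' : Fin (a.t k)), (k, z.val) ∉ B → (k, z'.val) ∉ B →
      lev w k z = lev w k z' → z = z') : a.deg ≤ b.deg + B.card := by
  have h1 : ∀ k, a.t k ≤ b.t k + (B.filter fun p => p.1 = k).card := by
    intro k
    have hs : (Finset.univ.filter fun z : Fin (a.t k) => (k, z.val) ∉ B).card ≤ b.t k := by
      have := Finset.card_le_card_of_injOn (s := Finset.univ.filter fun z : Fin (a.t k) =>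
        (k, z.val) ∉ B) (t := (Finset.univ : Finset (Fin (b.t k)))) (lev w k)
        (fun _ _ => Finset.mem_coe.2 (Finset.mem_univ _))
        (fun z hz z' hz' h => hB k z z' (by simpa using hz) (by simpa using hz') h)
      simpa using this
    have hc : (Finset.univ.filter fun z : Fin (a.t k) => (k, z.val) ∈ B).card ≤
        (B.filter fun p => p.1 = k).card := by
      refine Finset.card_le_card_of_injOn (fun z => (k, z.val)) (fun z hz => ?_)
        (fun z _ z' _ h => Fin.ext (by simpa using h))
      simpa using hz
    have := Finset.card_filter_add_card_filter_not (s := (Finset.univ : Finset (Fin (a.t k))))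
      (fun z => (k, z.val) ∈ B)
    simp only [Finset.card_univ, Fintype.card_fin] at this
    omega
  have h2 : ∑ k ∈ Finset.range n, (B.filter fun p => p.1 = k).card ≤ B.card := by
    rw [Finset.sum_card_fiberwise_eq_card_filter]
    exact Finset.card_filter_le _ _
  calc a.deg ≤ ∑ k ∈ Finset.range n, (b.t k + (B.filter fun p => p.1 = k).card) :=
        Finset.sum_le_sum fun k _ => h1 k
    _ ≤ b.deg + B.card := by
        rw [Finset.sum_add_distrib]
        exact Nat.add_le_add_left h2 _

/-- A morphism factors through `w` as soon as it is compatible with the total preorder on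
vertices which `w` induces over each vertex of its target. -/
theorem exists_factor (w : a ⟶ b) (w' : a ⟶ c)
    (h : ∀ k (z z' : Fin (a.t k)), lev w (k + 1) (a.map k z) = lev w (k + 1) (a.map k z') →
      lev w k z ≤ lev w k z' → lev w' k z ≤ lev w' k z') : ∃ x : b ⟶ c, w ≫ x = w' := by
  have hker : ∀ k z z', lev w k z = lev w k z' → lev w' k z = lev w' k z' := by
    intro k z z' hz
    have hm : lev w (k + 1) (a.map k z) = lev w (k + 1) (a.map k z') := by
      rw [lev_map, lev_map, hz]
    exact le_antisymm (h k z z' hm hz.le) (h k z' z hm.symm hz.ge)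
  let x : ∀ k, Fin (b.t k) → Fin (c.t k) := fun k y =>
    lev w' k (Function.surjInv (lev_surjective w k) y)
  have hx : ∀ k z, x k (lev w k z) = lev w' k z := fun k z =>
    hker k _ _ (Function.surjInv_eq (lev_surjective w k) _)
  refine ⟨(⟨x, fun k y => ?_, fun k y => ?_, fun k y y' hy hle => ?_⟩ : PTreeHom b c),
    hom_ext fun k z => hx k z⟩
  · obtain ⟨z, rfl⟩ := lev_surjective w' k y
    exact ⟨lev w k z, hx k z⟩
  · obtain ⟨z, rfl⟩ := lev_surjective w k y
    rw [← lev_map, hx, hx, lev_map]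
  · obtain ⟨z, rfl⟩ := lev_surjective w k y
    obtain ⟨z', rfl⟩ := lev_surjective w k y'
    rw [hx, hx]
    exact h k z z' (by rw [lev_map, lev_map, hy]) hle

/-- The quotient of a tree by a compatible family of total preorders, each given by a key. -/
theorem exists_quotient (a : PTree n) (κ : ∀ k, Fin (a.t k) → ℕ)
    (hmap : ∀ k z z', κ k z ≤ κ k z' → κ (k + 1) (a.map k z) ≤ κ (k + 1) (a.map k z'))
    (hfib : ∀ k z z', a.map k z = a.map k z' → z ≤ z' → κ k z ≤ κ k z') :
    ∃ (b : PTree n) (w : a ⟶ b), ∀ k z z', lev w k z ≤ lev w k z' ↔ κ k z ≤ κ k z' := by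
  let m : ℕ → ℕ := fun k => (Finset.univ.image (κ k)).card
  let q : ∀ k, Fin (a.t k) → Fin (m k) := fun k z =>
    ((Finset.univ.image (κ k)).orderIsoOfFin rfl).symm
      ⟨κ k z, Finset.mem_image_of_mem _ (Finset.mem_univ z)⟩
  have hq : ∀ k z z', q k z ≤ q k z' ↔ κ k z ≤ κ k z' := fun k z z' => by
    simp only [q, OrderIso.le_iff_le, Subtype.mk_le_mk]
  have hqs : ∀ k, Function.Surjective (q k) := by
    intro k y
    obtain ⟨z, -, hz⟩ := Finset.mem_image.1
      (((Finset.univ.image (κ k)).orderIsoOfFin rfl) y).2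
    refine ⟨z, ?_⟩
    simp only [q, OrderIso.symm_apply_eq]
    exact Subtype.ext hz
  let p : ∀ k, Fin (m k) → Fin (m (k + 1)) := fun k y =>
    q (k + 1) (a.map k (Function.surjInv (hqs k) y))
  have hp : ∀ k z, p k (q k z) = q (k + 1) (a.map k z) := by
    intro k z
    have hz := Function.surjInv_eq (hqs k) (q k z)
    refine le_antisymm ?_ ?_
    · exact (hq _ _ _).2 (hmap k _ _ ((hq _ _ _).1 hz.le))
    · exact (hq _ _ _).2 (hmap k _ _ ((hq _ _ _).1 hz.ge))
  have hmono : ∀ k, Monotone (p k) := by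
    intro k y y' hy
    obtain ⟨z, rfl⟩ := hqs k y
    obtain ⟨z', rfl⟩ := hqs k y'
    rw [hp, hp]
    exact (hq _ _ _).2 (hmap k _ _ ((hq _ _ _).1 hy))
  have hsurj : ∀ k, Function.Surjective (p k) := by
    intro k y
    obtain ⟨z, rfl⟩ := hqs (k + 1) y
    obtain ⟨z', rfl⟩ := a.surjmap k z
    exact ⟨q k z', hp k z'⟩
  have htop : ∀ k, n ≤ k → m k = 1 := by
    intro k hk
    have h1 := a.top k hk
    have h2 : m k ≤ a.t k := by simpa using Fintype.card_le_of_surjective _ (hqs k)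
    have h3 := (q k ⟨0, by omega⟩).isLt
    omega
  exact ⟨⟨m, p, hmono, hsurj, htop⟩, (⟨q, hqs, fun k z => (hp k z).symm,
    fun k z z' h hz => (hq k z z').2 (hfib k z z' h hz)⟩ :
      PTreeHom a ⟨m, p, hmono, hsurj, htop⟩), hq⟩

theorem mul_add_le_mul_add_iff {N x x' r r' : ℕ} (hr : r < N) (hr' : r' < N) :
    x * N + r ≤ x' * N + r' ↔ x < x' ∨ x = x' ∧ r ≤ r' := by
  rcases lt_trichotomy x x' with h | rfl | h
  · have := Nat.mul_le_mul_right N (Nat.succ_le_of_lt h)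
    rw [Nat.succ_mul] at this
    simp only [h, true_or, iff_true]
    omega
  · simp
  · have := Nat.mul_le_mul_right N (Nat.succ_le_of_lt h)
    rw [Nat.succ_mul] at this
    constructor
    · intro; omega
    · rintro (h' | ⟨h', -⟩) <;> omega

/-- Keys comparing vertices first through their ancestors, then through `g`, then through `f`. -/
def lexKey (a : PTree n) (f g : ∀ k, Fin (a.t k) → ℕ) : ℕ → ∀ k, Fin (a.t k) → ℕ
  | 0, _, _ => 0
  | d + 1, k, z =>
    (lexKey a f g d (k + 1) (a.map k z) * (Finset.univ.sup (g k) + 1) + g k z) *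
      (Finset.univ.sup (f k) + 1) + f k z

theorem lexKey_le_iff (a : PTree n) (f g : ∀ k, Fin (a.t k) → ℕ) (d k : ℕ)
    (z z' : Fin (a.t k)) :
    lexKey a f g (d + 1) k z ≤ lexKey a f g (d + 1) k z' ↔
      lexKey a f g d (k + 1) (a.map k z) < lexKey a f g d (k + 1) (a.map k z') ∨
      lexKey a f g d (k + 1) (a.map k z) = lexKey a f g d (k + 1) (a.map k z') ∧
        (g k z < g k z' ∨ g k z = g k z' ∧ f k z ≤ f k z') := by
  have hs : ∀ (h : ∀ k, Fin (a.t k) → ℕ) z, h k z < Finset.univ.sup (h k) + 1 := fun h z =>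
    Nat.lt_succ_of_le (Finset.le_sup (Finset.mem_univ z))
  have h1 := mul_add_le_mul_add_iff (x := lexKey a f g d (k + 1) (a.map k z))
    (x' := lexKey a f g d (k + 1) (a.map k z')) (hs g z) (hs g z')
  have h2 := mul_add_le_mul_add_iff (x := lexKey a f g d (k + 1) (a.map k z'))
    (x' := lexKey a f g d (k + 1) (a.map k z)) (hs g z') (hs g z)
  rw [lexKey, lexKey, mul_add_le_mul_add_iff (hs f z) (hs f z')]
  omega

/-- A factorization of a morphism of pruned trees. -/
structure Fac (u : a ⟶ b) where
  mid : PTree n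
  fst : a ⟶ mid
  snd : mid ⟶ b
  fac : fst ≫ snd = u

namespace Fac

variable {u : a ⟶ b}

/-- Both factors have positive degree. -/
def Proper (A : Fac u) : Prop := A.mid.deg < a.deg ∧ b.deg < A.mid.deg

/-- Two proper factorizations, the second of which refines the first one. -/
def Linked (A B : Fac u) : Prop := A.Proper ∧ B.Proper ∧ ∃ x, A.fst ≫ x = B.fst

/-- The first factor orders vertices lexicographically through their parents, then through `u`,
then through `f`. -/
def IsLex (f : ∀ k, Fin (a.t k) → ℕ) (A : Fac u) : Prop :=
  ∀ k z x, lev A.fst k z ≤ lev A.fst k x ↔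
    lev A.fst (k + 1) (a.map k z) < lev A.fst (k + 1) (a.map k x) ∨
    lev A.fst (k + 1) (a.map k z) = lev A.fst (k + 1) (a.map k x) ∧
      (lev u k z < lev u k x ∨ lev u k z = lev u k x ∧ f k z ≤ f k x)

/-- Monotonicity of `f` on the intersections of fibers of the tree with fibers of `u`. -/
def FiberMono (u : a ⟶ b) (f : ∀ k, Fin (a.t k) → ℕ) : Prop :=
  ∀ k z z', a.map k z = a.map k z' → lev u k z = lev u k z' → z ≤ z' → f k z ≤ f k z'

theorem exists_isLex (u : a ⟶ b) {f : ∀ k, Fin (a.t k) → ℕ} (hf : FiberMono u f) :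
    ∃ A : Fac u, A.IsLex f := by
  let κ : ∀ k, Fin (a.t k) → ℕ := fun k => lexKey a f (fun k z => lev u k z) (n - k) k
  have hκ : ∀ k z z', κ k z ≤ κ k z' ↔ κ (k + 1) (a.map k z) < κ (k + 1) (a.map k z') ∨
      κ (k + 1) (a.map k z) = κ (k + 1) (a.map k z') ∧
      (lev u k z < lev u k z' ∨ lev u k z = lev u k z' ∧ f k z ≤ f k z') := by
    intro k z z'
    by_cases hk : n ≤ k
    · obtain rfl := a.eq_of_le hk z z'
      simp
    · have : n - k = n - (k + 1) + 1 := by omega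
      simp only [κ, this, lexKey_le_iff, Fin.lt_def, Fin.ext_iff]
  obtain ⟨m, w, hw⟩ := exists_quotient a κ
    (fun k z z' h => by
      rcases (hκ k z z').1 h with h | h
      exacts [h.le, h.1.le])
    (fun k z z' h hz => by
      refine (hκ k z z').2 (Or.inr ⟨by rw [h], ?_⟩)
      rcases (lev_mono u h hz).lt_or_eq with hu | hu
      exacts [Or.inl hu, Or.inr ⟨hu, hf k z z' h hu hz⟩])
  have hlex : ∀ k z z', lev w k z ≤ lev w k z' ↔
      lev w (k + 1) (a.map k z) < lev w (k + 1) (a.map k z') ∨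
      lev w (k + 1) (a.map k z) = lev w (k + 1) (a.map k z') ∧
      (lev u k z < lev u k z' ∨ lev u k z = lev u k z' ∧ f k z ≤ f k z') := by
    intro k z z'
    have hlt := (hw (k + 1) (a.map k z') (a.map k z)).not
    have heq := and_congr (hw (k + 1) (a.map k z) (a.map k z')) (hw (k + 1) (a.map k z') (a.map k z))
    rw [not_le, not_le] at hlt
    rw [← le_antisymm_iff, ← le_antisymm_iff] at heq
    rw [hw, hκ, hlt, heq]
  obtain ⟨v, hv⟩ := exists_factor w u fun k z z' h hz => by
    rcases (hlex k z z').1 hz with h' | ⟨-, h' | h'⟩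
    exacts [absurd h h'.ne, h'.le, h'.1.le]
  exact ⟨⟨m, w, v, hv⟩, hlex⟩

theorem lev_fst_snd (A : Fac u) (k : ℕ) (z : Fin (a.t k)) :
    lev A.snd k (lev A.fst k z) = lev u k z := by
  rw [← lev_comp, A.fac]

theorem lev_le_of_fst_le (A : Fac u) {k : ℕ} {z z' : Fin (a.t k)}
    (h : lev A.fst (k + 1) (a.map k z) = lev A.fst (k + 1) (a.map k z'))
    (hz : lev A.fst k z ≤ lev A.fst k z') : lev u k z ≤ lev u k z' := by
  rw [← A.lev_fst_snd, ← A.lev_fst_snd]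
  exact lev_mono _ (by rw [← lev_map, ← lev_map, h]) hz

theorem IsLex.eq_of_eq {f : ∀ k, Fin (a.t k) → ℕ} {A : Fac u} (hA : A.IsLex f) {k : ℕ}
    {z z' : Fin (a.t k)} (h : lev A.fst k z = lev A.fst k z') : f k z = f k z' := by
  have hm : lev A.fst (k + 1) (a.map k z) = lev A.fst (k + 1) (a.map k z') := by
    rw [lev_map, lev_map, h]
  have hu : lev u k z = lev u k z' := by rw [← A.lev_fst_snd, ← A.lev_fst_snd, h]
  have h1 := (hA k z z').1 h.le
  have h2 := (hA k z' z).1 h.ge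
  simp only [hm, hu, lt_irrefl, true_and, false_or] at h1 h2
  exact le_antisymm h1 h2

theorem IsLex.le_of_le {f : ∀ k, Fin (a.t k) → ℕ} {A : Fac u} (hA : A.IsLex f) {k : ℕ}
    {z z' : Fin (a.t k)}
    (hm : lev A.fst (k + 1) (a.map k z) = lev A.fst (k + 1) (a.map k z'))
    (hu : lev u k z = lev u k z') (h : lev A.fst k z ≤ lev A.fst k z') : f k z ≤ f k z' := by
  simpa only [hm, hu, lt_irrefl, true_and, false_or] using (hA k z z').1 h

theorem IsLex.fst_eq {f : ∀ k, Fin (a.t k) → ℕ} {A : Fac u} (hA : A.IsLex f) {k : ℕ}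
    {z z' : Fin (a.t k)}
    (hm : lev A.fst (k + 1) (a.map k z) = lev A.fst (k + 1) (a.map k z'))
    (hu : lev u k z = lev u k z') (h : f k z = f k z') : lev A.fst k z = lev A.fst k z' :=
  le_antisymm ((hA k z z').2 (Or.inr ⟨hm, Or.inr ⟨hu, h.le⟩⟩))
    ((hA k z' z).2 (Or.inr ⟨hm.symm, Or.inr ⟨hu.symm, h.ge⟩⟩))

theorem IsLex.exists_factor {f : ∀ k, Fin (a.t k) → ℕ} {A C : Fac u} (hC : C.IsLex f)
    (h : ∀ k z z', lev A.fst (k + 1) (a.map k z) = lev A.fst (k + 1) (a.map k z') →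
      lev u k z = lev u k z' → lev A.fst k z ≤ lev A.fst k z' → f k z ≤ f k z') :
    ∃ x, A.fst ≫ x = C.fst := by
  have hker : ∀ d k, n - k = d → ∀ z z', lev A.fst k z = lev A.fst k z' →
      lev C.fst k z = lev C.fst k z' := by
    intro d
    induction d with
    | zero =>
      intro k hk z z' _
      rw [a.eq_of_le (by omega) z z']
    | succ d ih =>
      intro k hk z z' hz
      have hm : lev A.fst (k + 1) (a.map k z) = lev A.fst (k + 1) (a.map k z') := by
        rw [lev_map, lev_map, hz]
      have hu : lev u k z = lev u k z' := by rw [← A.lev_fst_snd, ← A.lev_fst_snd, hz]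
      exact hC.fst_eq (ih (k + 1) (by omega) _ _ hm) hu
        (le_antisymm (h k z z' hm hu hz.le) (h k z' z hm.symm hu.symm hz.ge))
  refine PTree.exists_factor _ _ fun k z z' hm hz => (hC k z z').2 (Or.inr ⟨?_, ?_⟩)
  · exact hker _ _ rfl _ _ hm
  · rcases (A.lev_le_of_fst_le hm hz).lt_or_eq with hu | hu
    exacts [Or.inl hu, Or.inr ⟨hu, h k z z' hm hu hz⟩]

end Fac

/-- The rank function on each level which ignores the gaps between `x` and `x + 1` at level `k`
for `(k, x) ∈ E`. -/
def gapRank (a : PTree n) (E : Finset (ℕ × ℕ)) (k : ℕ) (z : Fin (a.t k)) : ℕ :=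
  Nat.count (fun x => (k, x) ∉ E) z

theorem gapRank_mono (a : PTree n) (E : Finset (ℕ × ℕ)) (k : ℕ) : Monotone (a.gapRank E k) :=
  fun _ _ h => Nat.count_monotone _ h

theorem gapRank_le (a : PTree n) {E : Finset (ℕ × ℕ)} {k : ℕ} {z z' : Fin (a.t k)}
    (h : ∀ x, z'.val ≤ x → x < z.val → (k, x) ∈ E) : a.gapRank E k z ≤ a.gapRank E k z' := by
  rcases le_total z z' with hz | hz
  · exact a.gapRank_mono E k hz
  · have : ∀ m, z'.val ≤ m → m ≤ z.val → Nat.count (fun x => (k, x) ∉ E) m ≤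
        Nat.count (fun x => (k, x) ∉ E) z' := by
      intro m hm
      induction m, hm using Nat.le_induction with
      | base => intro _; exact le_rfl
      | succ m hm ih =>
        intro hle
        rw [Nat.count_succ, if_neg (not_not_intro (h m hm (by omega)))]
        exact ih (by omega)
    exact this z hz le_rfl

theorem mem_of_gapRank_le {a : PTree n} {E : Finset (ℕ × ℕ)} {k : ℕ} {z z' : Fin (a.t k)}
    (h : a.gapRank E k z ≤ a.gapRank E k z') {x : ℕ} (hx : z'.val ≤ x) (hx' : x < z.val) :
    (k, x) ∈ E := by
  by_contra hE
  have h1 : Nat.count (fun x => (k, x) ∉ E) z' ≤ Nat.count (fun x => (k, x) ∉ E) x :=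
    Nat.count_monotone _ hx
  have h2 : Nat.count (fun x => (k, x) ∉ E) x < Nat.count (fun x => (k, x) ∉ E) z :=
    Nat.count_strict_mono hE hx'
  exact absurd h (not_le.2 (h1.trans_lt h2))

theorem gapRank_le_of_subset {a : PTree n} {E E' : Finset (ℕ × ℕ)} (hE : E ⊆ E') {k : ℕ}
    {z z' : Fin (a.t k)} (h : a.gapRank E k z ≤ a.gapRank E k z') :
    a.gapRank E' k z ≤ a.gapRank E' k z' :=
  a.gapRank_le fun _ hx hx' => hE (mem_of_gapRank_le h hx hx')

theorem eq_of_gapRank_eq {a : PTree n} {E : Finset (ℕ × ℕ)} {k : ℕ} {z z' : Fin (a.t k)}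
    (hz : (k, z.val) ∉ E) (hzz : (k, z'.val) ∉ E) (h : a.gapRank E k z = a.gapRank E k z') :
    z = z' := by
  rcases lt_trichotomy z z' with hlt | rfl | hlt
  · exact absurd (mem_of_gapRank_le h.ge le_rfl hlt) hz
  · rfl
  · exact absurd (mem_of_gapRank_le h.le le_rfl hlt) hzz

/-- The vertices `y` and `y'` are consecutive siblings at level `i` identified by `u`. -/
def IsGap (u : a ⟶ b) (i : ℕ) (y y' : Fin (a.t i)) : Prop :=
  y'.val = y.val + 1 ∧ a.map i y = a.map i y' ∧ lev u i y = lev u i y'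

theorem exists_isGap (u : a ⟶ b) (h : b.deg < a.deg) :
    ∃ i y y', IsGap u i y y' ∧ ∀ k, i < k → Function.Injective (lev u k) := by
  classical
  have hex : ∃ k, k ≤ n ∧ ¬ Function.Injective (lev u k) := by
    by_contra! hcon
    refine absurd h (not_lt.2 (Finset.sum_le_sum fun k hk => ?_))
    simpa using Fintype.card_le_of_injective _ (hcon k (Finset.mem_range.1 hk).le)
  obtain ⟨k₀, hk₀, hk₀'⟩ := hex
  set i := Nat.findGreatest (fun k => ¬ Function.Injective (lev u k)) n with hi
  have hin : ¬ Function.Injective (lev u i) :=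
    Nat.findGreatest_spec (P := fun k => ¬ Function.Injective (lev u k)) hk₀ hk₀'
  have hinj : ∀ k, i < k → Function.Injective (lev u k) := by
    intro k hk
    by_cases hkn : k ≤ n
    · exact not_not.1 (Nat.findGreatest_is_greatest hk hkn)
    · exact fun z z' _ => a.eq_of_le (by omega) z z'
  obtain ⟨z, z', hz, hne⟩ : ∃ z z', lev u i z = lev u i z' ∧ z < z' := by
    simp only [Function.Injective, not_forall] at hin
    obtain ⟨z, z', h, hne⟩ := hin
    rcases lt_or_gt_of_ne hne with h' | h'
    exacts [⟨z, z', h, h'⟩, ⟨z', z, h.symm, h'⟩]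
  have hmap : a.map i z = a.map i z' := hinj _ (Nat.lt_succ_self i) (by
    rw [lev_map, lev_map, hz])
  let y : Fin (a.t i) := ⟨z.val + 1, by have := z'.isLt; rw [Fin.lt_def] at hne; omega⟩
  have hzy : z ≤ y := by simp [y, Fin.le_def]
  have hyz : y ≤ z' := by simpa [y, Fin.le_def] using Nat.succ_le_of_lt hne
  have hy : a.map i z = a.map i y :=
    le_antisymm (a.mono i hzy) (hmap ▸ a.mono i hyz)
  exact ⟨i, z, y, ⟨rfl, hy, le_antisymm (lev_mono u hy hzy)
    (hz ▸ lev_mono u (hy.symm.trans hmap) hyz)⟩, hinj⟩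

/-- A morphism of degree one identifies a single pair of consecutive siblings. -/
theorem injective_of_deg_eq (w : a ⟶ b) (h : a.deg = b.deg + 1) {i : ℕ} {y y' : Fin (a.t i)}
    (hy : IsGap w i y y') :
    (∀ k, k ≠ i → Function.Injective (lev w k)) ∧
      ∀ z z', z ≠ y → z' ≠ y → lev w i z = lev w i z' → z = z' := by
  have hne : y ≠ y' := by
    rintro rfl
    have := hy.1
    omega
  have hlt := t_lt w hne hy.2.2
  have hin : i ∈ Finset.range n := by
    by_contra hk
    exact hne (a.eq_of_le (by simpa using hk) y y')
  have hsum : ∀ k, k ≠ i → a.t k = b.t k ∨ n ≤ k := by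
    intro k hk
    by_contra! hcon
    have hkn : k ∈ (Finset.range n).erase i := by simp [hk, hcon.2]
    have h1 := Finset.add_sum_erase _ a.t hin
    have h2 := Finset.add_sum_erase _ b.t hin
    have h3 : ∑ k ∈ (Finset.range n).erase i, b.t k < ∑ k ∈ (Finset.range n).erase i, a.t k :=
      Finset.sum_lt_sum (fun k _ => t_le w k)
        ⟨k, hkn, lt_of_le_of_ne (t_le w k) (Ne.symm hcon.1)⟩
    simp only [deg] at h
    omega
  have hti : a.t i = b.t i + 1 := by
    have h1 := Finset.add_sum_erase _ a.t hin
    have h2 := Finset.add_sum_erase _ b.t hin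
    have h3 : ∑ k ∈ (Finset.range n).erase i, b.t k ≤ ∑ k ∈ (Finset.range n).erase i, a.t k :=
      Finset.sum_le_sum (fun k _ => t_le w k)
    simp only [deg] at h
    omega
  constructor
  · intro k hk
    rcases hsum k hk with he | hkn
    · exact ((Fintype.bijective_iff_surjective_and_card (lev w k)).2
        ⟨lev_surjective w k, by simp [he]⟩).1
    · exact fun z z' _ => a.eq_of_le hkn z z'
  · let r : {z : Fin (a.t i) // z ≠ y} → Fin (b.t i) := fun z => lev w i z
    have hr : Function.Surjective r := by
      intro x
      obtain ⟨z, rfl⟩ := lev_surjective w i x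
      by_cases hz : z = y
      · exact ⟨⟨y', hne.symm⟩, by rw [hz, hy.2.2]⟩
      · exact ⟨⟨z, hz⟩, rfl⟩
    have hbij := (Fintype.bijective_iff_surjective_and_card r).2 ⟨hr, by
      rw [Fintype.card_subtype_compl]
      simp [hti]⟩
    intro z z' hz hz' he
    exact congrArg Subtype.val (@hbij.1 ⟨z, hz⟩ ⟨z', hz'⟩ he)

namespace Fac

variable {u : a ⟶ b}

theorem IsLex.proper {f : ∀ k, Fin (a.t k) → ℕ} {A : Fac u} (hA : A.IsLex f)
    (B : Finset (ℕ × ℕ))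
    (hf : ∀ k (z z' : Fin (a.t k)), (k, z.val) ∉ B → (k, z'.val) ∉ B → f k z = f k z' → z = z')
    (hB : b.deg + B.card < a.deg)
    {i : ℕ} {y y' : Fin (a.t i)} (hy : IsGap u i y y') (hfy : f i y = f i y') : A.Proper := by
  constructor
  · have hne : y ≠ y' := by
      rintro rfl
      have := hy.1
      omega
    exact deg_lt A.fst hne (hA.fst_eq (by rw [hy.2.1]) hy.2.2 hfy)
  · have := deg_le_add_card A.fst B fun k z z' hz hz' h => hf k z z' hz hz' (hA.eq_of_eq h)
    omega

theorem fiberMono_gapRank (u : a ⟶ b) (E : Finset (ℕ × ℕ)) : FiberMono u (a.gapRank E) :=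
  fun k _ _ _ _ h => a.gapRank_mono E k h

theorem gapRank_eq {i : ℕ} {y y' : Fin (a.t i)} (hy : IsGap u i y y') {E : Finset (ℕ × ℕ)}
    (hE : (i, y.val) ∈ E) : a.gapRank E i y = a.gapRank E i y' := by
  have h1 := hy.1
  refine le_antisymm (a.gapRank_mono E i (by rw [Fin.le_def]; omega)) (a.gapRank_le ?_)
  intro x hx hx'
  obtain rfl : x = y.val := by omega
  exact hE

theorem IsLex.proper_gapRank {A : Fac u} {E : Finset (ℕ × ℕ)} (hA : A.IsLex (a.gapRank E))
    (hE : b.deg + E.card < a.deg) {i : ℕ} {y y' : Fin (a.t i)} (hy : IsGap u i y y')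
    (hyE : (i, y.val) ∈ E) : A.Proper :=
  hA.proper E (fun _ _ _ hz hz' h => eq_of_gapRank_eq hz hz' h) hE hy (gapRank_eq hy hyE)

theorem eqvGen_of_isGap (hd : b.deg + 2 < a.deg) {i j : ℕ} {y y' : Fin (a.t i)}
    {z z' : Fin (a.t j)} (hy : IsGap u i y y') (hz : IsGap u j z z') {A C : Fac u}
    (hA : A.IsLex (a.gapRank {(i, y.val)})) (hC : C.IsLex (a.gapRank {(j, z.val)})) :
    Relation.EqvGen Linked A C := by
  have hcard : ({(i, y.val), (j, z.val)} : Finset (ℕ × ℕ)).card ≤ 2 := Finset.card_le_two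
  obtain ⟨D, hD⟩ := exists_isLex u (fiberMono_gapRank u {(i, y.val), (j, z.val)})
  have hDp : D.Proper := hD.proper_gapRank (by omega) hy (by simp)
  refine .trans _ D _ (.rel _ _ ⟨hA.proper_gapRank (by simp; omega) hy (by simp), hDp,
    hD.exists_factor fun k x x' hm hu hx => ?_⟩) (.symm _ _ (.rel _ _
    ⟨hC.proper_gapRank (by simp; omega) hz (by simp), hDp,
      hD.exists_factor fun k x x' hm hu hx => ?_⟩))
  · exact gapRank_le_of_subset (by simp) (hA.le_of_le hm hu hx)
  · exact gapRank_le_of_subset (by simp) (hC.le_of_le hm hu hx)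

/-- The gap rank at the gap `(j + 1, y)`, with the rank at level `j` replaced by `s`. -/
def shuffleRank (a : PTree n) (j y : ℕ) (s : Fin (a.t j) → ℕ) : ∀ k, Fin (a.t k) → ℕ :=
  Function.update (a.gapRank {(j + 1, y)}) j s

@[simp]
theorem shuffleRank_self (j y : ℕ) (s : Fin (a.t j) → ℕ) : shuffleRank a j y s j = s := by
  simp [shuffleRank]

theorem shuffleRank_of_ne {j k : ℕ} (y : ℕ) (s : Fin (a.t j) → ℕ) (h : k ≠ j) :
    shuffleRank a j y s k = a.gapRank {(j + 1, y)} k := by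
  simp [shuffleRank, h]

theorem fiberMono_shuffleRank {j y : ℕ} {s : Fin (a.t j) → ℕ}
    (hs : ∀ z z', a.map j z = a.map j z' → lev u j z = lev u j z' → z ≤ z' → s z ≤ s z') :
    FiberMono u (shuffleRank a j y s) := by
  intro k z z' hm hu hz
  by_cases hk : k = j
  · subst hk
    simpa using hs z z' hm hu hz
  · rw [shuffleRank_of_ne _ _ hk]
    exact a.gapRank_mono _ k hz

theorem IsLex.proper_shuffleRank {A : Fac u} {j : ℕ} {y y' : Fin (a.t (j + 1))}
    {s : Fin (a.t j) → ℕ} (hA : A.IsLex (shuffleRank a j y s)) (x : Fin (a.t j))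
    (hs : ∀ z z', z ≠ x → z' ≠ x → s z = s z' → z = z') (hd : b.deg + 2 < a.deg)
    (hy : IsGap u (j + 1) y y') : A.Proper := by
  have hcard : ({(j + 1, y.val), (j, x.val)} : Finset (ℕ × ℕ)).card ≤ 2 := Finset.card_le_two
  refine hA.proper {(j + 1, y.val), (j, x.val)} (fun k z z' hz hz' h => ?_) (by omega) hy ?_
  · simp only [Finset.mem_insert, Finset.mem_singleton, not_or] at hz hz'
    by_cases hk : k = j
    · subst hk
      simp only [Prod.mk.injEq, true_and] at hz hz'
      exact hs z z' (fun h => hz.2 (by rw [h])) (fun h => hz'.2 (by rw [h])) (by simpa using h)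
    · rw [shuffleRank_of_ne _ _ hk] at h
      exact eq_of_gapRank_eq (by simpa using hz.1) (by simpa using hz'.1) h
  · rw [shuffleRank_of_ne _ _ (Nat.succ_ne_self j)]
    exact gapRank_eq hy (by simp)

theorem exists_factor_shuffleRank {j : ℕ} {y : ℕ} {s g : Fin (a.t j) → ℕ} {A C : Fac u}
    (hA : A.IsLex (shuffleRank a j y s)) (hC : C.IsLex (shuffleRank a j y g))
    (h : ∀ z z', a.gapRank {(j + 1, y)} (j + 1) (a.map j z) =
      a.gapRank {(j + 1, y)} (j + 1) (a.map j z') → lev u j z = lev u j z' →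
      s z ≤ s z' → g z ≤ g z') : ∃ x, A.fst ≫ x = C.fst := by
  refine hC.exists_factor fun k z z' hm hu hz => ?_
  have hle := hA.le_of_le hm hu hz
  by_cases hk : k = j
  · subst hk
    have := hA.eq_of_eq hm
    rw [shuffleRank_of_ne _ _ (Nat.succ_ne_self k)] at this
    rw [shuffleRank_self] at hle ⊢
    exact h z z' this hu hle
  · rwa [shuffleRank_of_ne _ _ hk] at hle ⊢

/-- The inversions of `s` among the vertices which may be reordered when `y` and `y + 1` are
identified at level `j + 1`. -/
def inversions (u : a ⟶ b) (j y : ℕ) (s : Fin (a.t j) → ℕ) :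
    Finset (Fin (a.t j) × Fin (a.t j)) :=
  Finset.univ.filter fun p => p.1 < p.2 ∧ lev u j p.1 = lev u j p.2 ∧
    a.gapRank {(j + 1, y)} (j + 1) (a.map j p.1) = a.gapRank {(j + 1, y)} (j + 1) (a.map j p.2) ∧
    s p.2 < s p.1

theorem mem_inversions {j y : ℕ} {s : Fin (a.t j) → ℕ} {z z' : Fin (a.t j)} :
    (z, z') ∈ inversions u j y s ↔ z < z' ∧ lev u j z = lev u j z' ∧
    a.gapRank {(j + 1, y)} (j + 1) (a.map j z) = a.gapRank {(j + 1, y)} (j + 1) (a.map j z') ∧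
    s z' < s z := by
  simp [inversions]

/-- There is an inversion `(z, z')` of `s` such that no value of `s` lies strictly in between on
the vertices which may be reordered with `z`. -/
theorem exists_adjacent_inversion {j y : ℕ} {s : Fin (a.t j) → ℕ} (hs : Function.Injective s)
    (h : (inversions u j y s).Nonempty) :
    ∃ z z', (z, z') ∈ inversions u j y s ∧
      ∀ x, lev u j x = lev u j z → a.gapRank {(j + 1, y)} (j + 1) (a.map j x) =
        a.gapRank {(j + 1, y)} (j + 1) (a.map j z) → x ≠ z → x ≠ z' → s x < s z' ∨ s z < s x := by
  obtain ⟨⟨z, z'⟩, hz, hmin⟩ :=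
    Finset.exists_min_image (inversions u j y s) (fun p => s p.1 - s p.2) h
  refine ⟨z, z', hz, fun x hu hg hxz hxz' => ?_⟩
  rw [mem_inversions] at hz
  by_contra! hcon
  have h1 : s x ≠ s z := fun h => hxz (hs h)
  have h2 : s x ≠ s z' := fun h => hxz' (hs h)
  rcases lt_or_gt_of_ne hxz' with hlt | hlt
  · have := hmin (x, z') (mem_inversions.2
      ⟨hlt, hu.trans hz.2.1, hg.trans hz.2.2.1, by omega⟩)
    simp only at this
    omega
  · have := hmin (z, x) (mem_inversions.2 ⟨hz.1.trans hlt, hu.symm, hg.symm, by omega⟩)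
    simp only at this
    omega

theorem eqvGen_shuffleRank (hd : b.deg + 2 < a.deg) {j : ℕ} {y y' : Fin (a.t (j + 1))}
    (hy : IsGap u (j + 1) y y') {C : Fac u} (hC : C.IsLex (a.gapRank {(j + 1, y.val)}))
    (N : ℕ) : ∀ (s : Fin (a.t j) → ℕ), (inversions u j y s).card = N → Function.Injective s →
      (∀ z z', a.map j z = a.map j z' → lev u j z = lev u j z' → z ≤ z' → s z ≤ s z') →
      ∀ A : Fac u, A.IsLex (shuffleRank a j y s) → Relation.EqvGen Linked A C := by
  induction N using Nat.strong_induction_on with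
  | _ N ih =>
  intro s hN hinj hs A hA
  have hAp : A.Proper := by
    have hne : a.t j ≠ 0 := by
      obtain ⟨z, -⟩ := a.surjmap j y
      have := z.isLt
      omega
    exact hA.proper_shuffleRank ⟨0, by omega⟩ (fun _ _ _ _ h => hinj h) hd hy
  rcases (inversions u j y s).eq_empty_or_nonempty with he | hne
  · refine .rel _ _ ⟨hAp, hC.proper_gapRank (by simp; omega) hy (by simp),
      hC.exists_factor fun k z z' hm hu hz => ?_⟩
    have hle := hA.le_of_le hm hu hz
    by_cases hk : k = j
    · subst hk
      refine a.gapRank_mono _ _ (not_lt.1 fun hlt => ?_)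
      have hg := hA.eq_of_eq hm
      rw [shuffleRank_of_ne _ _ (Nat.succ_ne_self k)] at hg
      rw [shuffleRank_self] at hle
      have : (z', z) ∈ inversions u k y s := mem_inversions.2
        ⟨hlt, hu.symm, hg.symm, lt_of_le_of_ne hle fun h => hlt.ne' (hinj h)⟩
      rw [he] at this
      exact absurd this (Finset.notMem_empty _)
    · rwa [shuffleRank_of_ne _ _ hk] at hle
  · obtain ⟨z, z', hz, hadj⟩ := exists_adjacent_inversion hinj hne
    have hz' := mem_inversions.1 hz
    obtain ⟨hlt, hu, hg, hslt⟩ := hz'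
    have hzne : z ≠ z' := hlt.ne
    set e := Equiv.swap z z' with he
    have hez : e z = z' := Equiv.swap_apply_left _ _
    have hez' : e z' = z := Equiv.swap_apply_right _ _
    have heo : ∀ x, x ≠ z → x ≠ z' → e x = x := fun x => Equiv.swap_apply_of_ne_of_ne
    set g := Function.update s z (s z') with hgdef
    have hgz : g z = s z' := Function.update_self ..
    have hgo : ∀ x, x ≠ z → g x = s x := fun x hx => Function.update_of_ne hx ..
    have hginj : ∀ x x', x ≠ z → x' ≠ z → g x = g x' → x = x' := fun x x' hx hx' h => by
      rw [hgo x hx, hgo x' hx'] at h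
      exact hinj h
    have hsg : ∀ x x', a.gapRank {(j + 1, y.val)} (j + 1) (a.map j x) =
        a.gapRank {(j + 1, y.val)} (j + 1) (a.map j x') → lev u j x = lev u j x' →
        s x ≤ s x' → g x ≤ g x' := by
      intro x x' h1 h2 h3
      grind
    have heg : ∀ x x', a.gapRank {(j + 1, y.val)} (j + 1) (a.map j x) =
        a.gapRank {(j + 1, y.val)} (j + 1) (a.map j x') → lev u j x = lev u j x' →
        (s ∘ e) x ≤ (s ∘ e) x' → g x ≤ g x' := by
      intro x x' h1 h2 h3
      simp only [Function.comp_apply] at h3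
      grind
    have hgm : ∀ x x', a.map j x = a.map j x' → lev u j x = lev u j x' → x ≤ x' →
        g x ≤ g x' := fun x x' h1 h2 h3 => hsg x x' (by rw [h1]) h2 (hs x x' h1 h2 h3)
    have hem : ∀ x x', a.map j x = a.map j x' → lev u j x = lev u j x' → x ≤ x' →
        (s ∘ e) x ≤ (s ∘ e) x' := by
      intro x x' h1 h2 h3
      have h4 := hs x x' h1 h2 h3
      have h5 : a.gapRank {(j + 1, y.val)} (j + 1) (a.map j x) =
        a.gapRank {(j + 1, y.val)} (j + 1) (a.map j x') := by rw [h1]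
      have h6 : ¬ (x = z ∧ x' = z') := by
        rintro ⟨rfl, rfl⟩
        omega
      have h7 : ¬ (x = z' ∧ x' = z) := by
        rintro ⟨rfl, rfl⟩
        exact absurd h3 (not_le.2 hlt)
      simp only [Function.comp_apply]
      clear hs hsg heg hgm ih
      grind
    have hcard : (inversions u j y (s ∘ e)).card < N := by
      rw [← hN]
      refine Finset.card_lt_card (Finset.ssubset_iff_of_subset ?_ |>.2 ⟨(z, z'), hz, ?_⟩)
      · rintro ⟨x, x'⟩ hx
        rw [mem_inversions] at hx ⊢
        obtain ⟨h1, h2, h3, h4⟩ := hx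
        refine ⟨h1, h2, h3, ?_⟩
        simp only [Function.comp_apply] at h4
        clear hs hsg heg hgm ih hem
        have h7 : ¬ (x = z' ∧ x' = z) := by
          rintro ⟨rfl, rfl⟩
          exact absurd h1 (not_lt.2 hlt.le)
        grind
      · rw [mem_inversions]
        rintro ⟨-, -, -, h4⟩
        simp only [Function.comp_apply, hez, hez'] at h4
        omega
    obtain ⟨D, hD⟩ := exists_isLex u (fiberMono_shuffleRank (y := y) hgm)
    obtain ⟨A', hA'⟩ := exists_isLex u (fiberMono_shuffleRank (y := y) hem)
    have hDp : D.Proper := hD.proper_shuffleRank z hginj hd hy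
    have heinj : Function.Injective (s ∘ e) := hinj.comp e.injective
    have hA'p : A'.Proper := hA'.proper_shuffleRank z (fun _ _ _ _ h => heinj h) hd hy
    exact .trans _ D _ (.rel _ _ ⟨hAp, hDp, exists_factor_shuffleRank hA hD hsg⟩)
      (.trans _ A' _ (.symm _ _ (.rel _ _ ⟨hA'p, hDp, exists_factor_shuffleRank hA' hD heg⟩))
        (ih _ hcard _ rfl heinj hem A' hA'))

theorem exists_eqvGen_of_deg_eq (hd : b.deg + 2 < a.deg) (A : Fac u)
    (hA : a.deg = A.mid.deg + 1) :
    ∃ i y y', IsGap u i y y' ∧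
      ∀ C : Fac u, C.IsLex (a.gapRank {(i, y.val)}) → Relation.EqvGen Linked A C := by
  obtain ⟨i, y, y', hy, hinj⟩ := exists_isGap A.fst (by omega)
  have hyu : IsGap u i y y' :=
    ⟨hy.1, hy.2.1, by rw [← A.lev_fst_snd, ← A.lev_fst_snd, hy.2.2]⟩
  refine ⟨i, y, y', hyu, fun C hC => ?_⟩
  have hAp : A.Proper := ⟨by omega, by omega⟩
  obtain ⟨hne, hi⟩ := injective_of_deg_eq A.fst hA hy
  have hle : ∀ k z z', (k ≠ i → k + 1 ≠ i) →
      lev A.fst (k + 1) (a.map k z) = lev A.fst (k + 1) (a.map k z') →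
      lev A.fst k z ≤ lev A.fst k z' → a.gapRank {(i, y.val)} k z ≤ a.gapRank {(i, y.val)} k z' := by
    intro k z z' hk hm hz
    have hmap : a.map k z = a.map k z' := by
      refine hne _ ?_ hm
      by_cases h : k = i
      · omega
      · exact hk h
    rcases le_or_gt z z' with hlt | hlt
    · exact a.gapRank_mono _ k hlt
    have he : lev A.fst k z = lev A.fst k z' := le_antisymm hz (lev_mono _ hmap.symm hlt.le)
    by_cases h : k = i
    · subst h
      have hy1 := hy.1
      have hy2 := hy.2.2
      refine a.gapRank_le fun x hx hx' => ?_
      have hyy : y' ≠ y := by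
        rintro rfl
        omega
      have hz' : z' = y := by
        by_contra hz'
        by_cases hzy : z = y
        · have := hi z' y' hz' hyy (by rw [← he, hzy, hy2])
          subst this hzy
          rw [Fin.lt_def] at hlt
          omega
        · exact hlt.ne (hi z' z hz' hzy he.symm)
      have hzy' : z = y' := hi z y' (fun h => hlt.ne (hz'.trans h.symm)) hyy
        (by rw [he, hz', hy2])
      subst hz' hzy'
      simp only [Finset.mem_singleton, Prod.mk.injEq, true_and]
      omega
    · exact absurd (hne k h he) hlt.ne'
  cases i with
  | zero =>
    exact .rel _ _ ⟨hAp, hC.proper_gapRank (by simp; omega) hyu (by simp),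
      hC.exists_factor fun k z z' hm _ hz => hle k z z' (by simp) hm hz⟩
  | succ j =>
    let s : Fin (a.t j) → ℕ := fun z => (lev A.fst j z).val
    have hs : Function.Injective s := fun z z' h => hne j (by omega) (Fin.ext h)
    have hsm : ∀ z z', a.map j z = a.map j z' → lev u j z = lev u j z' → z ≤ z' → s z ≤ s z' :=
      fun z z' h _ hz => lev_mono A.fst h hz
    obtain ⟨D, hD⟩ := exists_isLex u (fiberMono_shuffleRank (y := y) hsm)
    have hne0 : a.t j ≠ 0 := by
      obtain ⟨z, -⟩ := a.surjmap j y
      have := z.isLt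
      omega
    have hDp : D.Proper :=
      hD.proper_shuffleRank ⟨0, by omega⟩ (fun _ _ _ _ h => hs h) hd hyu
    refine .trans _ D _ (.rel _ _ ⟨hAp, hDp, hD.exists_factor fun k z z' hm _ hz => ?_⟩)
      (eqvGen_shuffleRank hd hyu hC _ s rfl hs hsm D hD)
    by_cases hk : k = j
    · subst hk
      rw [shuffleRank_self]
      exact hz
    · rw [shuffleRank_of_ne _ _ hk]
      exact hle k z z' (by omega) hm hz

/-- Every morphism of positive degree factors through a morphism of degree one. -/
theorem exists_deg_eq (u : a ⟶ b) (h : b.deg < a.deg) : ∃ A : Fac u, a.deg = A.mid.deg + 1 := by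
  obtain ⟨i, y, y', hy, -⟩ := exists_isGap u h
  obtain ⟨A, hA⟩ := exists_isLex u (fiberMono_gapRank u {(i, y.val)})
  refine ⟨A, ?_⟩
  have h1 := deg_le_add_card A.fst {(i, y.val)} fun k z z' hz hz' h =>
    eq_of_gapRank_eq hz hz' (hA.eq_of_eq h)
  have hne : y ≠ y' := by
    rintro rfl
    have := hy.1
    omega
  have h2 := deg_lt A.fst hne (hA.fst_eq (by rw [hy.2.1]) hy.2.2 (gapRank_eq hy (by simp)))
  rw [Finset.card_singleton] at h1
  omega

/-- The proper factorizations of a morphism of degree at least three are connected. -/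
theorem eqvGen_linked (hd : b.deg + 2 < a.deg) (A B : Fac u) (hA : A.Proper) (hB : B.Proper) :
    Relation.EqvGen Linked A B := by
  have key : ∀ A : Fac u, A.Proper → ∃ i y y', IsGap u i y y' ∧
      ∀ C : Fac u, C.IsLex (a.gapRank {(i, y.val)}) → Relation.EqvGen Linked A C := by
    intro A hA
    obtain ⟨D, hD⟩ := exists_deg_eq A.fst hA.1
    let D' : Fac u := ⟨D.mid, D.fst, D.snd ≫ A.snd, by rw [← Category.assoc, D.fac, A.fac]⟩
    obtain ⟨i, y, y', hy, h⟩ := exists_eqvGen_of_deg_eq hd D' hD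
    refine ⟨i, y, y', hy, fun C hC => .trans _ D' _ (.symm _ _ (.rel _ _ ⟨⟨?_, ?_⟩, hA, D.snd,
      D.fac⟩)) (h C hC)⟩
    · change D.mid.deg < _
      omega
    · change _ < D.mid.deg
      omega
  obtain ⟨i, y, y', hy, hA'⟩ := key A hA
  obtain ⟨j, z, z', hz, hB'⟩ := key B hB
  obtain ⟨C, hC⟩ := exists_isLex u (fiberMono_gapRank u {(i, y.val)})
  obtain ⟨D, hD⟩ := exists_isLex u (fiberMono_gapRank u {(j, z.val)})
  exact .trans _ C _ (hA' C hC) (.trans _ D _ (eqvGen_of_isGap hd hy hz hC hD)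
    (.symm _ _ (hB' D hD)))

end Fac

/-- A morphism of degree zero is an identity. -/
theorem isIdentityHom_of_deg_eq (u : a ⟶ b) (h : a.deg = b.deg) : IsIdentityHom u := by
  have ht : a.t = b.t := by
    have hs := (Finset.sum_eq_sum_iff_of_le fun k _ => t_le u k).1 h.symm
    funext k
    by_cases hk : k < n
    · exact (hs k (Finset.mem_range.2 hk)).symm
    · rw [a.top k (by omega), b.top k (by omega)]
  obtain ⟨t, f, hf, hfs, htop⟩ := a
  obtain ⟨t', g, hg, hgs, htop'⟩ := b
  obtain rfl : t = t' := ht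
  have hid : ∀ d k, n - k = d → ∀ z, lev u k z = z := by
    intro d
    induction d with
    | zero => exact fun k hk z => eq_of_le ⟨t, f, hf, hfs, htop⟩ (k := k) (by omega) _ _
    | succ d ih =>
      intro k hk
      have hbij := Finite.injective_iff_surjective.2 (lev_surjective u k)
      have hfg : ∀ z, f k z = g k (lev u k z) := fun z =>
        (ih (k + 1) (by omega) (f k z)).symm.trans (lev_map u k z)
      have hmono : Monotone (lev u k) := by
        intro z z' hz
        rcases (hf k hz).lt_or_eq with hlt | he
        · rw [hfg, hfg] at hlt
          exact (not_le.1 fun hle => absurd (hg k hle) (not_le.2 hlt)).le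
        · exact lev_mono u he hz
      have hsm := hmono.strictMono_of_injective hbij
      let e := StrictMono.orderIsoOfSurjective (lev u k) hsm (lev_surjective u k)
      intro z
      have : e = OrderIso.refl _ := Subsingleton.elim _ _
      exact congrArg (fun e : Fin (t k) ≃o Fin (t k) => e z) this
  have hfg : f = g := by
    funext k z
    have := lev_map u k z
    rw [hid _ _ rfl, hid _ _ rfl] at this
    exact this
  subst hfg
  exact ⟨rfl, hom_ext fun k z => hid _ k rfl z⟩

/-- A tree as an object of the path category. -/
def vtx (a : PTree n) : Paths (TreeVert n) := (Paths.of (TreeVert n)).obj ⟨a⟩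

/-- The composite of a path of morphisms of degree one. -/
def eval (p : vtx a ⟶ vtx b) : a ⟶ b := (pathsLift n).map p

theorem homDeg_eq_one (w : a ⟶ b) (h : a.deg = b.deg + 1) : homDeg w = 1 := by
  simp [homDeg, h]

/-- A morphism of degree one as a path. -/
def arrow (w : a ⟶ b) (h : a.deg = b.deg + 1) : vtx a ⟶ vtx b :=
  (Paths.of (TreeVert n)).map (X := ⟨a⟩) (Y := ⟨b⟩) ⟨w, homDeg_eq_one w h⟩

theorem eval_id : eval (𝟙 (vtx a)) = 𝟙 a := (pathsLift n).map_id _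

theorem eval_comp (p : vtx a ⟶ vtx b) (q : vtx b ⟶ vtx c) : eval (p ≫ q) = eval p ≫ eval q :=
  (pathsLift n).map_comp p q

theorem eval_arrow (w : a ⟶ b) (h : a.deg = b.deg + 1) : eval (arrow w h) = w :=
  Paths.lift_toPath _ _

theorem path_cases {motive : ∀ b, (vtx a ⟶ vtx b) → Prop} (id : motive a (𝟙 _))
    (comp : ∀ b c (p : vtx a ⟶ vtx c) (w : c ⟶ b) h, motive b (p ≫ arrow w h)) (b : PTree n)
    (p : vtx a ⟶ vtx b) : motive b p := by
  refine Paths.induction_fixed_source (a := vtx a) (fun {b} p => motive b.tree p) id ?_ p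
  intro x y p q _
  have hq := q.2
  simp only [homDeg] at hq
  exact comp y.tree x.tree p q.1 (by omega)

theorem path_deg_le (p : vtx a ⟶ vtx b) : b.deg ≤ a.deg := deg_le (eval p)

theorem path_deg_eq (p : vtx a ⟶ vtx b) (h : a.deg = b.deg) :
    ∃ h : a = b, p = eqToHom (congrArg vtx h) := by
  revert h
  refine path_cases (motive := fun b p => a.deg = b.deg →
    ∃ h : a = b, p = eqToHom (congrArg vtx h)) (fun _ => ⟨rfl, rfl⟩) ?_ b p
  intro b c p w h h'
  have := path_deg_le p
  omega

theorem path_deg_lt (p : vtx a ⟶ vtx b) (h : b.deg < a.deg) :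
    ∃ (c : PTree n) (q : vtx a ⟶ vtx c) (w : c ⟶ b) (h : _), p = q ≫ arrow w h := by
  revert h
  refine path_cases (motive := fun b p => b.deg < a.deg → ∃ (c : PTree n) (q : vtx a ⟶ vtx c)
    (w : c ⟶ b) (h : _), p = q ≫ arrow w h) (fun h => absurd h (lt_irrefl _)) ?_ b p
  exact fun b c q w h _ => ⟨c, q, w, h, rfl⟩

theorem path_deg_eq_one (p : vtx a ⟶ vtx b) (h : a.deg = b.deg + 1) : p = arrow (eval p) h := by
  obtain ⟨c, q, w, hw, rfl⟩ := path_deg_lt p (by omega)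
  obtain ⟨rfl, rfl⟩ := path_deg_eq q (by omega)
  simp only [eqToHom_refl, Category.id_comp, eval_arrow]

theorem exists_eval_eq (u : a ⟶ b) : ∃ p : vtx a ⟶ vtx b, eval p = u := by
  obtain ⟨d, hd⟩ := Nat.exists_eq_add_of_le (deg_le u)
  induction d generalizing a with
  | zero =>
    obtain ⟨rfl, rfl⟩ := isIdentityHom_of_deg_eq u (by omega)
    exact ⟨𝟙 _, eval_id⟩
  | succ d ih =>
    obtain ⟨A, hA⟩ := Fac.exists_deg_eq u (by omega)
    obtain ⟨p, hp⟩ := ih A.snd (by omega)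
    exact ⟨arrow A.fst hA ≫ p, by rw [eval_comp, eval_arrow, hp, A.fac]⟩

/-- The class of a path modulo the quadratic relations. -/
def cls (p : vtx a ⟶ vtx b) :
    (Quotient.functor (relR n)).obj (vtx a) ⟶ (Quotient.functor (relR n)).obj (vtx b) :=
  (Quotient.functor (relR n)).map p

theorem cls_comp (p : vtx a ⟶ vtx b) (q : vtx b ⟶ vtx c) : cls (p ≫ q) = cls p ≫ cls q :=
  (Quotient.functor (relR n)).map_comp p q

theorem cls_arrow_comp_arrow {c' : PTree n} (w : a ⟶ c) (v : c ⟶ b) (w' : a ⟶ c') (v' : c' ⟶ b)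
    (hw : a.deg = c.deg + 1) (hv : c.deg = b.deg + 1) (hw' : a.deg = c'.deg + 1)
    (hv' : c'.deg = b.deg + 1) (h : w ≫ v = w' ≫ v') :
    cls (arrow w hw ≫ arrow v hv) = cls (arrow w' hw' ≫ arrow v' hv') :=
  CategoryTheory.Quotient.sound _ ⟨⟨c⟩, ⟨c'⟩, ⟨w, homDeg_eq_one w hw⟩, ⟨v, homDeg_eq_one v hv⟩,
    ⟨w', homDeg_eq_one w' hw'⟩, ⟨v', homDeg_eq_one v' hv'⟩, rfl, rfl, h⟩

/-- A path representing a morphism. -/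
noncomputable def pathOf (u : a ⟶ b) : vtx a ⟶ vtx b := (exists_eval_eq u).choose

theorem eval_pathOf (u : a ⟶ b) : eval (pathOf u) = u := (exists_eval_eq u).choose_spec

theorem cls_eq_of_eval_eq (D : ℕ) : ∀ {a b : PTree n} (p q : vtx a ⟶ vtx b),
    a.deg = b.deg + D → eval p = eval q → cls p = cls q := by
  induction D using Nat.strong_induction_on with
  | _ D ih =>
  intro a b p q hD hpq
  obtain rfl | rfl | rfl | hD3 : D = 0 ∨ D = 1 ∨ D = 2 ∨ 3 ≤ D := by omega
  · obtain ⟨h, rfl⟩ := path_deg_eq p hD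
    obtain ⟨h', rfl⟩ := path_deg_eq q hD
    rfl
  · rw [path_deg_eq_one p hD, path_deg_eq_one q hD]
    simp only [hpq]
  · obtain ⟨c, p', v, hv, rfl⟩ := path_deg_lt p (by omega)
    obtain ⟨c', q', v', hv', rfl⟩ := path_deg_lt q (by omega)
    rw [eval_comp, eval_comp, eval_arrow, eval_arrow] at hpq
    rw [path_deg_eq_one p' (by omega), path_deg_eq_one q' (by omega)]
    exact cls_arrow_comp_arrow _ _ _ _ _ _ _ _ hpq
  · let T : Fac (eval p) → _ := fun A => cls (pathOf A.fst) ≫ cls (pathOf A.snd)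
    have hlift : ∀ {c : PTree n} (r : vtx a ⟶ vtx c) (s : vtx c ⟶ vtx b)
        (A : Fac (eval p)) (x : c ⟶ A.mid), c.deg < a.deg → b.deg < c.deg →
        A.Proper → eval r ≫ x = A.fst → x ≫ A.snd = eval s → cls (r ≫ s) = T A := by
      intro c r s A x h1 h2 hA h3 h4
      have hs : cls s = cls (pathOf x ≫ pathOf A.snd) :=
        ih (c.deg - b.deg) (by omega) _ _ (by omega)
          (by rw [eval_comp, eval_pathOf, eval_pathOf, h4])
      have hAle := deg_le x
      have hr : cls (r ≫ pathOf x) = cls (pathOf A.fst) :=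
        ih (a.deg - A.mid.deg) (by have := hA.2; omega) _ _ (by have := hA.1; omega)
          (by rw [eval_comp, eval_pathOf, eval_pathOf, h3])
      rw [cls_comp, hs, cls_comp, ← Category.assoc, ← cls_comp, hr]
    have hT : ∀ A B : Fac (eval p), Relation.EqvGen Fac.Linked A B → T A = T B := by
      intro A B h
      induction h with
      | rel A B h =>
        obtain ⟨hA, hB, x, hx⟩ := h
        have hsnd : x ≫ B.snd = A.snd := by
          refine hom_ext fun k z => ?_
          obtain ⟨z, rfl⟩ := lev_surjective A.fst k z
          rw [← lev_comp, ← lev_comp, ← Category.assoc, hx, A.fac, B.fac]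
        have := hlift (pathOf A.fst) (pathOf A.snd) B x hA.1 hA.2 hB
          (by rw [eval_pathOf, hx]) (by rw [eval_pathOf, hsnd])
        rw [← this, cls_comp]
      | refl A => rfl
      | symm A B _ h => exact h.symm
      | trans A B C _ _ h h' => exact h.trans h'
    have hpath : ∀ r : vtx a ⟶ vtx b, eval r = eval p →
        ∃ A : Fac (eval p), A.Proper ∧ cls r = T A := by
      intro r hr
      obtain ⟨c, r', v, hv, rfl⟩ := path_deg_lt r (by omega)
      rw [eval_comp, eval_arrow] at hr
      have hP : Fac.Proper (⟨c, eval r', v, hr⟩ : Fac (eval p)) :=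
        ⟨by change c.deg < _; omega, by change _ < c.deg; omega⟩
      exact ⟨_, hP, hlift r' (arrow v hv) _ (𝟙 c) hP.1 hP.2 hP (Category.comp_id _)
        (by rw [eval_arrow]; exact Category.id_comp _)⟩
    obtain ⟨A, hA, hpA⟩ := hpath p rfl
    obtain ⟨B, hB, hqB⟩ := hpath q hpq.symm
    rw [hpA, hqB, hT A B (Fac.eqvGen_linked (by omega) A B hA hB)]

end PTree

/-- STATEMENT 18: the canonical functor from the path category of the quiver
of degree-1 morphisms induces an isomorphism of categories from the quotient
of the path category by the congruence generated by the quadratic relations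
(one for each degree-2 morphism of `Ω_n^epi`, identifying its two
factorizations into degree-1 morphisms) onto `Ω_n^epi`: the induced functor
is bijective on objects and on every hom-set. -/
theorem stmt_18 (n : ℕ) (hn : 1 ≤ n) :
    ∃ H : ∀ (a b : CategoryTheory.Paths (TreeVert n)) (p q : a ⟶ b),
        relR n p q → (pathsLift n).map p = (pathsLift n).map q,
      Function.Bijective
        (CategoryTheory.Quotient.lift (relR n) (pathsLift n) H).obj ∧
      ∀ (a b : CategoryTheory.Quotient (relR n)),
        Function.Bijective
          (fun f : a ⟶ b =>
            (CategoryTheory.Quotient.lift (relR n) (pathsLift n) H).map f) := by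
  have H : ∀ (a b : CategoryTheory.Paths (TreeVert n)) (p q : a ⟶ b),
      relR n p q → (pathsLift n).map p = (pathsLift n).map q := by
    rintro a b _ _ ⟨θ₁, θ₂, w₁, v₁, w₂, v₂, rfl, rfl, h⟩
    have hmap : ∀ {x y : TreeVert n} (w : x ⟶ y),
        (pathsLift n).map ((Paths.of (V := TreeVert n)).map w) = w.val :=
      fun w => Paths.lift_toPath _ w
    exact ((pathsLift n).map_comp _ _).trans <| (congrArg₂ (· ≫ ·) (hmap w₁) (hmap v₁)).trans <|
      h.trans <| (congrArg₂ (· ≫ ·) (hmap w₂) (hmap v₂)).symm.trans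
        ((pathsLift n).map_comp _ _).symm
  refine ⟨H, ⟨?_, fun a => ⟨⟨PTree.vtx a⟩, rfl⟩⟩, ?_⟩
  · rintro ⟨⟨a⟩⟩ ⟨⟨b⟩⟩ h
    obtain rfl : a = b := h
    rfl
  · rintro ⟨⟨a⟩⟩ ⟨⟨b⟩⟩
    refine ⟨fun f g h => ?_, fun u => ?_⟩
    · obtain ⟨p, rfl⟩ := (Quotient.functor (relR n)).map_surjective f
      obtain ⟨q, rfl⟩ := (Quotient.functor (relR n)).map_surjective g
      obtain ⟨d, hd⟩ := Nat.exists_eq_add_of_le (PTree.path_deg_le (a := a) (b := b) p)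
      exact PTree.cls_eq_of_eval_eq d (a := a) (b := b) p q hd h
    · obtain ⟨p, hp⟩ := PTree.exists_eval_eq (a := a) (b := b) u
      exact ⟨(Quotient.functor (relR n)).map p, hp⟩
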